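/- arXiv:1801.07452 — 2 statements merged into one kernel-verified Lean document; each statement's English description precedes it below -/
import Mathlib

section
/- Let n be a positive integer, let T be a real symmetric n×n matrix, and let t ∈ ℝⁿ be any vector of eigenvalues of T. Let f and g₀ be the spectral functions on S_n associated with proper lower-semicontinuous functions φ : ℝⁿ → (−∞,+∞] and ψ : ℝⁿ → (−∞,+∞] with dom φ ∩ dom ψ ≠ ∅. Then the infimum over C ∈ S_n of f(C) − tr(TC) + g₀(C) equals the infimum over d ∈ ℝⁿ of φ(d) − dᵀt + ψ(d) (both infima taken in [−∞,+∞]). -/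
open Matrix Filter Topology Set

noncomputable section

/-- A real matrix is orthogonal. -/
def IsOrth {n : ℕ} (U : Matrix (Fin n) (Fin n) ℝ) : Prop := Uᵀ * U = 1

/-- `d` is a vector of eigenvalues of `C`, i.e. `C = U Diag(d) Uᵀ` for some orthogonal `U`. -/
def IsEigVec {n : ℕ} (C : Matrix (Fin n) (Fin n) ℝ) (d : Fin n → ℝ) : Prop :=
  ∃ U : Matrix (Fin n) (Fin n) ℝ, IsOrth U ∧ C = U * Matrix.diagonal d * Uᵀ

/-- Invariance under permutations of coordinates. -/
def PermInv {n : ℕ} (φ : (Fin n → ℝ) → EReal) : Prop :=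
  ∀ (σ : Equiv.Perm (Fin n)) (d : Fin n → ℝ), φ (d ∘ σ) = φ d

/-- `F` is the spectral function on symmetric matrices associated with `φ`. -/
def IsSpectral {n : ℕ} (F : Matrix (Fin n) (Fin n) ℝ → EReal)
    (φ : (Fin n → ℝ) → EReal) : Prop :=
  PermInv φ ∧ ∀ (C : Matrix (Fin n) (Fin n) ℝ) (d : Fin n → ℝ), IsEigVec C d → F C = φ d

/-- A function with values in (−∞,+∞] (represented in `EReal`, so it never takes the value ⊥)
which is finite somewhere. -/
def IsProper {α : Type*} (φ : α → EReal) : Prop := (∃ x, φ x ≠ ⊤) ∧ ∀ x, φ x ≠ ⊥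

/-- Convexity for extended-real-valued functions. -/
def EConvex {E : Type*} [AddCommGroup E] [Module ℝ E] (φ : E → EReal) : Prop :=
  ∀ (x y : E) (a b : ℝ), 0 ≤ a → 0 ≤ b → a + b = 1 →
    φ (a • x + b • y) ≤ (a : EReal) * φ x + (b : EReal) * φ y

/-- The class Γ₀ : proper, lower semicontinuous, convex functions into (−∞,+∞]. -/
def Gamma0 {E : Type*} [AddCommGroup E] [Module ℝ E] [TopologicalSpace E]
    (φ : E → EReal) : Prop :=
  IsProper φ ∧ LowerSemicontinuous φ ∧ EConvex φ

/-- Squared Frobenius norm. -/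
def frobSq {n : ℕ} (A : Matrix (Fin n) (Fin n) ℝ) : ℝ := ∑ i, ∑ j, (A i j) ^ 2

/-- Frobenius norm. -/
def frobNorm {n : ℕ} (A : Matrix (Fin n) (Fin n) ℝ) : ℝ := Real.sqrt (frobSq A)


lemma aux_eig {n : ℕ} (C : Matrix (Fin n) (Fin n) ℝ) (hC : C.IsSymm) : ∃ d, IsEigVec C d := by
  have hH : C.IsHermitian := by
    rw [Matrix.IsHermitian, Matrix.conjTranspose_eq_transpose_of_trivial]; exact hC
  refine ⟨hH.eigenvalues, (hH.eigenvectorUnitary : Matrix (Fin n) (Fin n) ℝ), ?_, ?_⟩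
  · have := (Matrix.mem_unitaryGroup_iff').1 hH.eigenvectorUnitary.2
    rwa [Matrix.star_eq_conjTranspose, Matrix.conjTranspose_eq_transpose_of_trivial] at this
  · have := hH.spectral_theorem
    rw [Unitary.conjStarAlgAut_apply, Matrix.star_eq_conjTranspose,
      Matrix.conjTranspose_eq_transpose_of_trivial] at this
    exact this

lemma aux_trace {n : ℕ} (W : Matrix (Fin n) (Fin n) ℝ) (t d : Fin n → ℝ) :
    (Matrix.diagonal t * (W * Matrix.diagonal d * Wᵀ)).trace
      = ∑ i, ∑ j, t i * d j * (W i j) ^ 2 := by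
  simp only [Matrix.trace, Matrix.diag_apply, Matrix.diagonal_mul]
  refine Finset.sum_congr rfl fun i _ => ?_
  rw [Matrix.mul_apply, Finset.mul_sum]
  refine Finset.sum_congr rfl fun j _ => ?_
  rw [Matrix.mul_diagonal, Matrix.transpose_apply]
  ring

lemma aux_perm {n : ℕ} (W : Matrix (Fin n) (Fin n) ℝ) (hW : Wᵀ * W = 1) (t d : Fin n → ℝ) :
    ∃ σ : Equiv.Perm (Fin n),
      ∑ i, ∑ j, t i * d j * (W i j) ^ 2 ≤ ∑ i, d (σ i) * t i := by
  have hW' : W * Wᵀ = 1 := mul_eq_one_comm.1 hW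
  have hM : (Matrix.of fun i j => (W i j) ^ 2) ∈ doublyStochastic ℝ (Fin n) := by
    rw [mem_doublyStochastic_iff_sum]
    refine ⟨fun i j => sq_nonneg _, fun i => ?_, fun j => ?_⟩
    · have := congrFun (congrFun hW' i) i
      simpa [Matrix.mul_apply, sq] using this
    · have := congrFun (congrFun hW j) j
      simpa [Matrix.mul_apply, sq] using this
  obtain ⟨w, hw0, hw1, hw⟩ := exists_eq_sum_perm_of_mem_doublyStochastic hM
  have key : ∑ i, ∑ j, t i * d j * (W i j) ^ 2 = ∑ σ, w σ * ∑ i, d (σ i) * t i := by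
    have h1 : ∀ i j, (W i j) ^ 2 = ∑ σ : Equiv.Perm (Fin n), w σ * σ.permMatrix ℝ i j := by
      intro i j
      have := congrFun (congrFun hw i) j
      simpa [Matrix.sum_apply] using this.symm
    have h2 : ∀ i, ∑ j, t i * d j * (W i j) ^ 2
        = ∑ σ : Equiv.Perm (Fin n), w σ * (d (σ i) * t i) := by
      intro i
      simp only [h1, Finset.mul_sum]
      rw [Finset.sum_comm]
      refine Finset.sum_congr rfl fun σ _ => ?_
      rw [Finset.sum_eq_single (σ i)]
      · simp [Equiv.Perm.permMatrix, PEquiv.toMatrix_apply]; ring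
      · intro j _ hj
        simp [Equiv.Perm.permMatrix, PEquiv.toMatrix_apply, Ne.symm hj]
      · simp
    simp only [h2, Finset.mul_sum]
    rw [Finset.sum_comm]
  by_contra! hcon
  set S := ∑ i, ∑ j, t i * d j * (W i j) ^ 2
  obtain ⟨σ₀, hσ₀⟩ : ∃ σ, 0 < w σ := by
    by_contra! h
    have : ∑ σ, w σ ≤ 0 := Finset.sum_nonpos fun σ _ => h σ
    linarith
  have : ∑ σ, w σ * ∑ i, d (σ i) * t i < ∑ σ, w σ * S :=
    Finset.sum_lt_sum (fun σ _ => mul_le_mul_of_nonneg_left (hcon σ).le (hw0 σ))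
      ⟨σ₀, Finset.mem_univ _, mul_lt_mul_of_pos_left (hcon σ₀) hσ₀⟩
  rw [← Finset.sum_mul, hw1, ← key] at this
  linarith

/-- Under the spectral assumptions, the infimum over symmetric matrices of
`f(C) − tr(TC) + g₀(C)` equals the infimum over `ℝⁿ` of `φ(d) − dᵀt + ψ(d)`, both in `EReal`. -/
theorem stmt1 (n : ℕ) (hn : 0 < n)
    (T : Matrix (Fin n) (Fin n) ℝ) (hT : T.IsSymm) (t : Fin n → ℝ) (ht : IsEigVec T t)
    (f g₀ : Matrix (Fin n) (Fin n) ℝ → EReal) (φ ψ : (Fin n → ℝ) → EReal)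
    (hφp : IsProper φ) (hψp : IsProper ψ)
    (hφl : LowerSemicontinuous φ) (hψl : LowerSemicontinuous ψ)
    (hf : IsSpectral f φ) (hg : IsSpectral g₀ ψ)
    (hdom : ∃ x : Fin n → ℝ, φ x ≠ ⊤ ∧ ψ x ≠ ⊤) :
    (⨅ C : {C : Matrix (Fin n) (Fin n) ℝ // C.IsSymm},
        f C.1 - (((T * C.1).trace : ℝ) : EReal) + g₀ C.1)
      = ⨅ d : Fin n → ℝ, (φ d - ((∑ i, d i * t i : ℝ) : EReal) + ψ d) := by
  obtain ⟨U, hU, hTU⟩ := ht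
  have hU' : U * Uᵀ = 1 := mul_eq_one_comm.1 hU
  apply le_antisymm
  · refine le_iInf fun d => ?_
    have hC : IsEigVec (U * Matrix.diagonal d * Uᵀ) d := ⟨U, hU, rfl⟩
    have hs : (U * Matrix.diagonal d * Uᵀ).IsSymm := by
      simp [Matrix.IsSymm, Matrix.transpose_mul, Matrix.mul_assoc]
    refine (iInf_le _ ⟨_, hs⟩).trans ?_
    have htr : (T * (U * Matrix.diagonal d * Uᵀ)).trace = ∑ i, d i * t i := by
      have : T * (U * Matrix.diagonal d * Uᵀ)
          = U * (Matrix.diagonal t * (Uᵀ * U) * Matrix.diagonal d * Uᵀ) := by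
        rw [hTU]; simp only [Matrix.mul_assoc]
      rw [this, Matrix.trace_mul_comm, Matrix.mul_assoc, (show Uᵀ * U = 1 from hU)]
      simp [Matrix.trace, mul_comm]
    simp only [hf.2 _ _ hC, hg.2 _ _ hC, htr]
    exact le_rfl
  · refine le_iInf fun C => ?_
    obtain ⟨C, hs⟩ := C
    obtain ⟨d, hC⟩ := aux_eig C hs
    obtain ⟨V, hV, hCV⟩ := id hC
    have hW : (Uᵀ * V)ᵀ * (Uᵀ * V) = 1 := by
      rw [Matrix.transpose_mul, Matrix.transpose_transpose, Matrix.mul_assoc,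
        ← Matrix.mul_assoc U, hU', Matrix.one_mul]
      exact hV
    obtain ⟨σ, hσ⟩ := aux_perm (Uᵀ * V) hW t d
    have htr : (T * C).trace ≤ ∑ i, d (σ i) * t i := by
      refine le_trans (le_of_eq ?_) hσ
      rw [← aux_trace]
      have h1 : T * C = U * (Matrix.diagonal t * Uᵀ * V * Matrix.diagonal d * Vᵀ) := by
        rw [hTU, hCV]; simp only [Matrix.mul_assoc]
      rw [h1, Matrix.trace_mul_comm]
      simp only [Matrix.transpose_mul, Matrix.transpose_transpose, Matrix.mul_assoc]
    refine (iInf_le _ (d ∘ σ)).trans ?_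
    simp only [hf.2 _ _ hC, hg.2 _ _ hC, hf.1 σ d, hg.1 σ d]
    refine add_le_add (EReal.sub_le_sub le_rfl ?_) le_rfl
    exact EReal.coe_le_coe_iff.2 htr
end
end

section
/- Let n be a positive integer, γ > 0, and let C̄, T ∈ S_n. Let f and g₀ be the spectral functions on S_n associated with φ ∈ Γ0(ℝⁿ) and with a proper lower-semicontinuous function ψ : ℝⁿ → (−∞,+∞], both invariant under permutations of coordinates, with dom φ ∩ dom ψ ≠ ∅, and assume ψ is bounded below by an affine function. Let λ ∈ ℝⁿ and let U be an orthogonal matrix with C̄ + γT = U Diag(λ) Uᵀ. Then the function x ↦ γ(φ(x) + ψ(x)) + ½‖x − λ‖² attains its minimum over ℝⁿ, and for every minimizer λ̂ of this function, the matrix U Diag(λ̂) Uᵀ is a minimizer over S_n of C ↦ γ(f(C) − tr(TC) + g₀(C)) + ½‖C − C̄‖_F². -/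
open Matrix Filter Topology Set

noncomputable section

lemma aux_frobSq {n : ℕ} (A : Matrix (Fin n) (Fin n) ℝ) : frobSq A = (Aᵀ * A).trace := by
  simp only [frobSq, Matrix.trace, Matrix.diag, Matrix.mul_apply, Matrix.transpose_apply]
  rw [Finset.sum_comm]
  simp only [pow_two]

lemma aux_tr {n : ℕ} (U V : Matrix (Fin n) (Fin n) ℝ) (m l : Fin n → ℝ) :
    ((V * diagonal m * Vᵀ) * (U * diagonal l * Uᵀ)).trace
      = ∑ i, ∑ j, m i * l j * ((Vᵀ * U) i j) ^ 2 := by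
  have h : ((V * diagonal m * Vᵀ) * (U * diagonal l * Uᵀ)).trace
      = (diagonal m * (Vᵀ * U) * (diagonal l * (Vᵀ * U)ᵀ)).trace := by
    rw [show (V * diagonal m * Vᵀ) * (U * diagonal l * Uᵀ)
      = V * (diagonal m * Vᵀ * (U * diagonal l * Uᵀ)) by simp only [Matrix.mul_assoc],
      Matrix.trace_mul_comm]
    simp only [Matrix.mul_assoc, Matrix.transpose_mul, Matrix.transpose_transpose]
  rw [h]
  generalize Vᵀ * U = W
  simp only [Matrix.trace, Matrix.diag]
  refine Finset.sum_congr rfl fun i _ => ?_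
  rw [Matrix.mul_apply]
  refine Finset.sum_congr rfl fun j _ => ?_
  rw [Matrix.diagonal_mul, Matrix.diagonal_mul, Matrix.transpose_apply]
  ring

lemma aux_symm {n : ℕ} (V : Matrix (Fin n) (Fin n) ℝ) (m : Fin n → ℝ) :
    (V * diagonal m * Vᵀ)ᵀ = V * diagonal m * Vᵀ := by
  simp [Matrix.transpose_mul, Matrix.mul_assoc]

lemma aux_tr_same {n : ℕ} (U : Matrix (Fin n) (Fin n) ℝ) (hU : IsOrth U) (m l : Fin n → ℝ) :
    ((U * diagonal m * Uᵀ) * (U * diagonal l * Uᵀ)).trace = ∑ i, m i * l i := by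
  rw [aux_tr, show Uᵀ * U = 1 from hU]
  refine Finset.sum_congr rfl fun i _ => ?_
  simp [Matrix.one_apply]

lemma aux_obj {n : ℕ} (γ : ℝ) (C B T : Matrix (Fin n) (Fin n) ℝ) (hC : Cᵀ = C) (hB : Bᵀ = B) :
    frobSq (C - B) / 2 - γ * (T * C).trace
      = (C * C).trace / 2 - (C * (B + γ • T)).trace + (B * B).trace / 2 := by
  rw [aux_frobSq]
  simp only [Matrix.transpose_sub, hC, hB, Matrix.sub_mul, Matrix.mul_sub, Matrix.mul_add,
    Matrix.trace_sub, Matrix.trace_add, Matrix.mul_smul, Matrix.trace_smul, smul_eq_mul]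
  rw [Matrix.trace_mul_comm B C, Matrix.trace_mul_comm T C]
  ring

lemma aux_birk {n : ℕ} (U V : Matrix (Fin n) (Fin n) ℝ) (hU : IsOrth U) (hV : IsOrth V)
    (m l : Fin n → ℝ) : ∃ σ : Equiv.Perm (Fin n),
      ∑ i, ∑ j, m i * l j * ((Vᵀ * U) i j) ^ 2 ≤ ∑ i, m (σ i) * l i := by
  unfold IsOrth at hU hV
  have hU' : U * Uᵀ = 1 := mul_eq_one_comm.mp hU
  have hV' : V * Vᵀ = 1 := mul_eq_one_comm.mp hV
  set W := Vᵀ * U with hW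
  have h1 : W * Wᵀ = 1 := by
    rw [hW, Matrix.transpose_mul, Matrix.transpose_transpose, Matrix.mul_assoc,
      ← Matrix.mul_assoc U, hU', Matrix.one_mul, hV]
  have h2 : Wᵀ * W = 1 := mul_eq_one_comm.mp h1
  have hM : (Matrix.of fun i j => (W i j) ^ 2) ∈ doublyStochastic ℝ (Fin n) := by
    rw [mem_doublyStochastic_iff_sum]
    refine ⟨fun i j => by simp [sq_nonneg], fun i => ?_, fun j => ?_⟩
    · have := congrFun (congrFun h1 i) i
      simpa [Matrix.mul_apply, pow_two] using this
    · have := congrFun (congrFun h2 j) j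
      simpa [Matrix.mul_apply, pow_two] using this
  obtain ⟨w, hw0, hw1, hw2⟩ := exists_eq_sum_perm_of_mem_doublyStochastic hM
  have key : ∑ i, ∑ j, m i * l j * (W i j) ^ 2
      = ∑ σ : Equiv.Perm (Fin n), w σ * ∑ i, m i * l (σ i) := by
    have : ∀ i j, (W i j) ^ 2 = ∑ σ : Equiv.Perm (Fin n), w σ * (if σ i = j then 1 else 0) := by
      intro i j
      have := congrFun (congrFun hw2 i) j
      simp only [Matrix.of_apply] at this
      rw [← this, Matrix.sum_apply]
      refine Finset.sum_congr rfl fun σ _ => ?_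
      simp [Equiv.Perm.permMatrix, PEquiv.toMatrix_apply, eq_comm]
    simp only [this, Finset.mul_sum]
    have e : ∀ i, ∑ j, ∑ σ : Equiv.Perm (Fin n), m i * l j * (w σ * (if σ i = j then 1 else 0))
        = ∑ σ : Equiv.Perm (Fin n), w σ * (m i * l (σ i)) := by
      intro i
      rw [Finset.sum_comm]
      refine Finset.sum_congr rfl fun σ _ => ?_
      simp
      ring
    simp only [e]
    rw [Finset.sum_comm]
  by_contra hcon
  push Not at hcon
  rw [key] at hcon
  have hlt : ∀ σ : Equiv.Perm (Fin n), w σ * ∑ i, m i * l (σ i)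
      ≤ w σ * ∑ σ : Equiv.Perm (Fin n), w σ * ∑ i, m i * l (σ i) := by
    intro σ
    refine mul_le_mul_of_nonneg_left ?_ (hw0 σ)
    refine le_trans (le_of_eq ?_) (hcon σ⁻¹).le
    rw [← Equiv.sum_comp σ (fun i => m (σ⁻¹ i) * l i)]
    simp
  obtain ⟨σ, hσ⟩ : ∃ σ, 0 < w σ := by
    by_contra h
    push Not at h
    have : ∑ σ, w σ ≤ 0 := Finset.sum_nonpos fun σ _ => h σ
    linarith
  have hs : ∑ σ : Equiv.Perm (Fin n), w σ * ∑ i, m i * l (σ i)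
      < ∑ σ : Equiv.Perm (Fin n), w σ * ∑ σ : Equiv.Perm (Fin n), w σ * ∑ i, m i * l (σ i) := by
    refine Finset.sum_lt_sum (fun σ _ => hlt σ) ⟨σ, Finset.mem_univ _, ?_⟩
    refine mul_lt_mul_of_pos_left ?_ hσ
    refine lt_of_le_of_lt (le_of_eq ?_) (hcon σ⁻¹)
    rw [← Equiv.sum_comp σ (fun i => m (σ⁻¹ i) * l i)]
    simp
  rw [← Finset.sum_mul, hw1, one_mul] at hs
  exact lt_irrefl _ hs

lemma aux_spec {n : ℕ} (C : Matrix (Fin n) (Fin n) ℝ) (hC : C.IsSymm) :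
    ∃ (V : Matrix (Fin n) (Fin n) ℝ) (m : Fin n → ℝ), IsOrth V ∧ C = V * diagonal m * Vᵀ := by
  have hH : C.IsHermitian := by
    rw [Matrix.IsHermitian, Matrix.conjTranspose_eq_transpose_of_trivial]; exact hC
  refine ⟨hH.eigenvectorUnitary, hH.eigenvalues, ?_, ?_⟩
  · have := Matrix.mem_unitaryGroup_iff'.1 (SetLike.coe_mem hH.eigenvectorUnitary)
    simpa [IsOrth, Matrix.star_eq_conjTranspose] using this
  · have := hH.spectral_theorem
    rw [Unitary.conjStarAlgAut_apply] at this
    simpa [Matrix.star_eq_conjTranspose, Function.comp_def] using this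

lemma aux_ereal {γ : ℝ} (hγ : 0 < γ) {a b : EReal} (ha : a ≠ ⊥) (hb : b ≠ ⊥) (t s : ℝ) :
    (γ : EReal) * (a - (t : EReal) + b) + (s : EReal)
      = (γ : EReal) * (a + b) + ((s - γ * t : ℝ) : EReal) := by
  have hT : (γ : EReal) * ⊤ = ⊤ := EReal.coe_mul_top_of_pos hγ
  induction a with
  | bot => exact absurd rfl ha
  | top =>
    rw [EReal.top_sub_coe, EReal.top_add_of_ne_bot hb, hT, EReal.top_add_coe, EReal.top_add_coe]
  | coe a =>
    induction b with
    | bot => exact absurd rfl hb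
    | top =>
      rw [← EReal.coe_sub, EReal.coe_add_top, EReal.coe_add_top, hT, EReal.top_add_coe,
        EReal.top_add_coe]
    | coe b =>
      norm_cast
      ring

lemma aux_lsc {n : ℕ} {γ : ℝ} (hγ : 0 < γ) {φ ψ : (Fin n → ℝ) → EReal} (lam : Fin n → ℝ)
    (hφ : LowerSemicontinuous φ) (hψ : LowerSemicontinuous ψ)
    (hφb : ∀ x, φ x ≠ ⊥) (hψb : ∀ x, ψ x ≠ ⊥) :
    LowerSemicontinuous fun x => (γ : EReal) * (φ x + ψ x)
      + (((∑ i, (x i - lam i) ^ 2) / 2 : ℝ) : EReal) := by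
  refine LowerSemicontinuous.add' ?_ ?_ ?_
  · have h1 : LowerSemicontinuous fun x => φ x + ψ x :=
      LowerSemicontinuous.add' hφ hψ fun x =>
        EReal.continuousAt_add (Or.inr (hψb x)) (Or.inl (hφb x))
    have hc : Continuous fun y : EReal => (γ : EReal) * y := by
      rw [continuous_iff_continuousAt]
      intro y
      have h0 : (γ : EReal) ≠ 0 := by exact_mod_cast hγ.ne'
      have := EReal.continuousAt_mul (p := ((γ : EReal), y)) (Or.inl h0) (Or.inl h0)
        (Or.inl (EReal.coe_ne_bot _)) (Or.inl (EReal.coe_ne_top _))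
      exact ContinuousAt.comp (f := fun y : EReal => ((γ : EReal), y)) this (by fun_prop)
    exact hc.comp_lowerSemicontinuous h1 fun a b h =>
      mul_le_mul_of_nonneg_left h (by exact_mod_cast hγ.le)
  · exact Continuous.lowerSemicontinuous (continuous_coe_real_ereal.comp (by fun_prop))
  · intro x
    exact EReal.continuousAt_add (Or.inr (EReal.coe_ne_bot _)) (Or.inr (EReal.coe_ne_top _))

lemma aux_minorant {n : ℕ} {φ : (Fin n → ℝ) → EReal} (hφ : Gamma0 φ) (x₀ : Fin n → ℝ)
    (hx₀ : φ x₀ ≠ ⊤) : ∃ (A B : ℝ), 0 ≤ A ∧ ∀ x, ((-A * ‖x - x₀‖ + B : ℝ) : EReal) ≤ φ x := by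
  obtain ⟨⟨-, hbot⟩, hlsc, hconv⟩ := hφ
  obtain ⟨c, hc⟩ : ∃ c : ℝ, φ x₀ = c := ⟨(φ x₀).toReal, (EReal.coe_toReal hx₀ (hbot _)).symm⟩
  have h1 : ((c - 1 : ℝ) : EReal) < φ x₀ := by
    rw [hc]; exact_mod_cast (by linarith : c - 1 < c)
  have h2 := hlsc x₀ _ h1
  obtain ⟨r, hr, hball⟩ := Metric.eventually_nhds_iff.1 h2
  have hr' : 0 < r / 2 := by linarith
  refine ⟨1 / (r / 2), c - 1, by positivity, fun x => ?_⟩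
  by_cases hx : dist x x₀ < r
  · refine le_trans ?_ (hball hx).le
    rw [EReal.coe_le_coe_iff]
    have : 0 ≤ 1 / (r / 2) * ‖x - x₀‖ := by positivity
    linarith
  · push Not at hx
    rw [dist_eq_norm] at hx
    have hN : 0 < ‖x - x₀‖ := by linarith
    by_cases hxt : φ x = ⊤
    · rw [hxt]; exact le_top
    obtain ⟨d, hd⟩ : ∃ d : ℝ, φ x = d := ⟨(φ x).toReal, (EReal.coe_toReal hxt (hbot _)).symm⟩
    set t := (r / 2) / ‖x - x₀‖ with ht
    have ht0 : 0 < t := by positivity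
    have ht1 : t ≤ 1 := by rw [ht, div_le_one hN]; linarith
    have hc1 := hconv x₀ x (1 - t) t (by linarith) ht0.le (by ring)
    have hmem : dist ((1 - t) • x₀ + t • x) x₀ < r := by
      rw [dist_eq_norm, show (1 - t) • x₀ + t • x - x₀ = t • (x - x₀) by module, norm_smul,
        Real.norm_of_nonneg ht0.le, ht, div_mul_cancel₀ _ hN.ne']
      linarith
    have hlt := (hball hmem).trans_le hc1
    rw [hc, hd] at hlt
    have hlt' : c - 1 < (1 - t) * c + t * d := by exact_mod_cast hlt
    rw [hd, EReal.coe_le_coe_iff]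
    have e : 1 / (r / 2) * ‖x - x₀‖ = 1 / t := by rw [ht]; field_simp
    have : c - 1 / t < d := by
      rw [sub_lt_iff_lt_add, ← sub_lt_iff_lt_add', lt_div_iff₀ ht0]
      nlinarith
    rw [neg_mul, e]
    linarith

lemma aux_exists {n : ℕ} {γ : ℝ} (hγ : 0 < γ) {φ ψ : (Fin n → ℝ) → EReal} (lam : Fin n → ℝ)
    (hφ : Gamma0 φ) (hψp : IsProper ψ) (hψl : LowerSemicontinuous ψ)
    (hdom : ∃ x : Fin n → ℝ, φ x ≠ ⊤ ∧ ψ x ≠ ⊤)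
    (haff : ∃ (a : Fin n → ℝ) (b : ℝ), ∀ x : Fin n → ℝ,
      (((∑ i, a i * x i) + b : ℝ) : EReal) ≤ ψ x) :
    ∃ lhat : Fin n → ℝ, ∀ x : Fin n → ℝ,
        (γ : EReal) * (φ lhat + ψ lhat) + (((∑ i, (lhat i - lam i) ^ 2) / 2 : ℝ) : EReal)
          ≤ (γ : EReal) * (φ x + ψ x) + (((∑ i, (x i - lam i) ^ 2) / 2 : ℝ) : EReal) := by
  obtain ⟨x₀, hx1, hx2⟩ := hdom
  obtain ⟨A, B, hA, hAB⟩ := aux_minorant hφ x₀ hx1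
  obtain ⟨a, b, hab⟩ := haff
  have hl := aux_lsc hγ lam hφ.2.1 hψl hφ.1.2 hψp.2
  set h : (Fin n → ℝ) → EReal := fun x => (γ : EReal) * (φ x + ψ x)
      + (((∑ i, (x i - lam i) ^ 2) / 2 : ℝ) : EReal) with hh
  obtain ⟨v, hv⟩ : ∃ v : ℝ, h x₀ = v := by
    obtain ⟨p, hp⟩ : ∃ p : ℝ, φ x₀ = p :=
      ⟨_, (EReal.coe_toReal hx1 (hφ.1.2 _)).symm⟩
    obtain ⟨q, hq⟩ : ∃ p : ℝ, ψ x₀ = p :=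
      ⟨_, (EReal.coe_toReal hx2 (hψp.2 _)).symm⟩
    refine ⟨γ * (p + q) + (∑ i, (x₀ i - lam i) ^ 2) / 2, ?_⟩
    simp only [hh, hp, hq]
    norm_cast
  -- real lower bound in terms of the distance to `lam`
  set D := ‖lam - x₀‖ with hD
  set S := ∑ i, |a i| with hS
  set K := ∑ i, a i * lam i with hK
  have hS0 : 0 ≤ S := Finset.sum_nonneg fun i _ => abs_nonneg _
  have hlow : ∀ x, ((γ * ((-A * (‖x - lam‖ + D) + B) + (K - S * ‖x - lam‖ + b))
      + ‖x - lam‖ ^ 2 / 2 : ℝ) : EReal) ≤ h x := by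
    intro x
    have e1 : ((-A * (‖x - lam‖ + D) + B : ℝ) : EReal) ≤ φ x := by
      refine le_trans ?_ (hAB x)
      rw [EReal.coe_le_coe_iff]
      have : ‖x - x₀‖ ≤ ‖x - lam‖ + D := by
        rw [hD]; simpa using norm_add_le (x - lam) (lam - x₀)
      nlinarith
    have e2 : ((K - S * ‖x - lam‖ + b : ℝ) : EReal) ≤ ψ x := by
      refine le_trans ?_ (hab x)
      rw [EReal.coe_le_coe_iff]
      have : ∑ i, a i * lam i - ∑ i, a i * x i ≤ S * ‖x - lam‖ := by
        rw [← Finset.sum_sub_distrib, hS, Finset.sum_mul]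
        refine Finset.sum_le_sum fun i _ => ?_
        have h3 : |(x - lam) i| ≤ ‖x - lam‖ := norm_le_pi_norm (x - lam) i
        calc a i * lam i - a i * x i ≤ |a i * lam i - a i * x i| := le_abs_self _
          _ = |a i| * |(x - lam) i| := by
            rw [← abs_mul, ← abs_neg]; congr 1; simp; ring
          _ ≤ _ := mul_le_mul_of_nonneg_left h3 (abs_nonneg _)
      linarith
    have e3 : ‖x - lam‖ ^ 2 ≤ ∑ i, (x i - lam i) ^ 2 := by
      have h0 : 0 ≤ ∑ i, (x i - lam i) ^ 2 := Finset.sum_nonneg fun i _ => sq_nonneg _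
      have : ‖x - lam‖ ≤ Real.sqrt (∑ i, (x i - lam i) ^ 2) := by
        rw [pi_norm_le_iff_of_nonneg (Real.sqrt_nonneg _)]
        intro i
        rw [Real.norm_eq_abs]
        refine Real.abs_le_sqrt ?_
        exact Finset.single_le_sum (f := fun i => (x i - lam i) ^ 2)
          (fun i _ => sq_nonneg _) (Finset.mem_univ i)
      calc ‖x - lam‖ ^ 2 ≤ Real.sqrt (∑ i, (x i - lam i) ^ 2) ^ 2 := by gcongr
        _ = _ := Real.sq_sqrt h0
    rw [EReal.coe_add, EReal.coe_mul, EReal.coe_add (-A * (‖x - lam‖ + D) + B)]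
    refine add_le_add (mul_le_mul_of_nonneg_left (add_le_add e1 e2) (by exact_mod_cast hγ.le)) ?_
    rw [EReal.coe_le_coe_iff]
    linarith
  -- radius
  set P := γ * (A + S) with hP
  set Q := |v - γ * (-A * D + B + K + b)| with hQ
  have hP0 : 0 ≤ P := by positivity
  have hQ0 : 0 ≤ Q := abs_nonneg _
  set R := 2 * P + 2 * Q + 1 + ‖x₀ - lam‖ with hR
  have hx₀R : x₀ ∈ Metric.closedBall lam R := by
    rw [Metric.mem_closedBall, dist_eq_norm]
    linarith
  obtain ⟨z, hz, hmin⟩ := LowerSemicontinuousOn.exists_isMinOn ⟨x₀, hx₀R⟩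
    (isCompact_closedBall lam R) (hl.lowerSemicontinuousOn _)
  refine ⟨z, fun x => ?_⟩
  change h z ≤ h x
  by_cases hx : x ∈ Metric.closedBall lam R
  · exact hmin hx
  · refine (hmin hx₀R).trans (le_trans ?_ (hlow x))
    rw [Metric.mem_closedBall, dist_eq_norm, not_le] at hx
    rw [hv, EReal.coe_le_coe_iff]
    have hn0 : 0 ≤ ‖x₀ - lam‖ := norm_nonneg _
    have hq : v - γ * (-A * D + B + K + b) ≤ Q := le_abs_self _
    set s := ‖x - lam‖
    have hs : 2 * P + 2 * Q + 1 ≤ s := by linarith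
    have : Q ≤ s ^ 2 / 2 - P * s := by nlinarith
    have e : γ * ((-A * (s + D) + B) + (K - S * s + b)) + s ^ 2 / 2
      = γ * (-A * D + B + K + b) + (s ^ 2 / 2 - P * s) := by rw [hP]; ring
    rw [e]
    linarith

/-- Proposition 1(i) of the paper. `γ > 0`, `C̄, T ∈ Sₙ`, `f`, `g₀` spectral with
`φ ∈ Γ₀(ℝⁿ)`, `ψ` proper lsc bounded below by an affine function, `dom φ ∩ dom ψ ≠ ∅`,
`C̄ + γT = U Diag(λ) Uᵀ` with `U` orthogonal. Then `x ↦ γ(φ(x)+ψ(x)) + ½‖x−λ‖²` attains its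
minimum, and for every minimizer `λ̂`, `U Diag(λ̂) Uᵀ` minimizes
`C ↦ γ(f(C) − tr(TC) + g₀(C)) + ½‖C − C̄‖_F²` over symmetric matrices. -/
theorem stmt4 (n : ℕ) (hn : 0 < n) (γ : ℝ) (hγ : 0 < γ)
    (Cbar T : Matrix (Fin n) (Fin n) ℝ) (hCbar : Cbar.IsSymm) (hT : T.IsSymm)
    (f g₀ : Matrix (Fin n) (Fin n) ℝ → EReal) (φ ψ : (Fin n → ℝ) → EReal)
    (hφ : Gamma0 φ) (hψp : IsProper ψ) (hψl : LowerSemicontinuous ψ)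
    (hf : IsSpectral f φ) (hg : IsSpectral g₀ ψ)
    (hdom : ∃ x : Fin n → ℝ, φ x ≠ ⊤ ∧ ψ x ≠ ⊤)
    (haff : ∃ (a : Fin n → ℝ) (b : ℝ), ∀ x : Fin n → ℝ,
      (((∑ i, a i * x i) + b : ℝ) : EReal) ≤ ψ x)
    (lam : Fin n → ℝ) (U : Matrix (Fin n) (Fin n) ℝ) (hU : IsOrth U)
    (hdec : Cbar + γ • T = U * Matrix.diagonal lam * Uᵀ) :
    (∃ lhat : Fin n → ℝ, ∀ x : Fin n → ℝ,
        (γ : EReal) * (φ lhat + ψ lhat) + (((∑ i, (lhat i - lam i) ^ 2) / 2 : ℝ) : EReal)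
          ≤ (γ : EReal) * (φ x + ψ x) + (((∑ i, (x i - lam i) ^ 2) / 2 : ℝ) : EReal)) ∧
    (∀ lhat : Fin n → ℝ,
      (∀ x : Fin n → ℝ,
        (γ : EReal) * (φ lhat + ψ lhat) + (((∑ i, (lhat i - lam i) ^ 2) / 2 : ℝ) : EReal)
          ≤ (γ : EReal) * (φ x + ψ x) + (((∑ i, (x i - lam i) ^ 2) / 2 : ℝ) : EReal)) →
      ∀ C : Matrix (Fin n) (Fin n) ℝ, C.IsSymm →
        (γ : EReal) * (f (U * Matrix.diagonal lhat * Uᵀ)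
              - (((T * (U * Matrix.diagonal lhat * Uᵀ)).trace : ℝ) : EReal)
              + g₀ (U * Matrix.diagonal lhat * Uᵀ))
            + ((frobSq (U * Matrix.diagonal lhat * Uᵀ - Cbar) / 2 : ℝ) : EReal)
          ≤ (γ : EReal) * (f C - (((T * C).trace : ℝ) : EReal) + g₀ C)
            + ((frobSq (C - Cbar) / 2 : ℝ) : EReal)) := by
  refine ⟨aux_exists hγ lam hφ hψp hψl hdom haff, fun lhat hmin C hC => ?_⟩
  obtain ⟨V, m, hV, hCV⟩ := aux_spec C hC
  obtain ⟨σ, hσ⟩ := aux_birk U V hU hV m lam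
  rw [hf.2 C m ⟨V, hV, hCV⟩, hg.2 C m ⟨V, hV, hCV⟩, hf.2 _ lhat ⟨U, hU, rfl⟩,
    hg.2 _ lhat ⟨U, hU, rfl⟩, aux_ereal hγ (hφ.1.2 _) (hψp.2 _),
    aux_ereal hγ (hφ.1.2 _) (hψp.2 _), aux_obj γ _ _ _ (aux_symm U lhat) hCbar,
    aux_obj γ _ _ _ hC hCbar, hdec, aux_tr_same U hU, aux_tr_same U hU, hCV, aux_tr_same V hV,
    aux_tr]
  have hm := hmin (m ∘ σ)
  rw [hf.1 σ m, hg.1 σ m] at hm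
  set k := (Cbar * Cbar).trace / 2 - (∑ i, lam i ^ 2) / 2 with hk
  have e1 : (∑ i, lhat i * lhat i) / 2 - ∑ i, lhat i * lam i + (Cbar * Cbar).trace / 2
      = (∑ i, (lhat i - lam i) ^ 2) / 2 + k := by
    have : ∑ i, (lhat i - lam i) ^ 2 = ∑ i, lhat i * lhat i - 2 * ∑ i, lhat i * lam i
        + ∑ i, lam i ^ 2 := by
      rw [Finset.mul_sum, ← Finset.sum_sub_distrib, ← Finset.sum_add_distrib]
      exact Finset.sum_congr rfl fun i _ => by ring
    rw [this, hk]; ring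
  have e2 : (∑ i, ((m ∘ σ) i - lam i) ^ 2) / 2 + k ≤ (∑ i, m i * m i) / 2
      - ∑ i, ∑ j, m i * lam j * ((Vᵀ * U) i j) ^ 2 + (Cbar * Cbar).trace / 2 := by
    have : ∑ i, ((m ∘ σ) i - lam i) ^ 2 = ∑ i, m (σ i) * m (σ i) - 2 * ∑ i, m (σ i) * lam i
        + ∑ i, lam i ^ 2 := by
      rw [Finset.mul_sum, ← Finset.sum_sub_distrib, ← Finset.sum_add_distrib]
      exact Finset.sum_congr rfl fun i _ => by simp only [Function.comp]; ring
    rw [this, hk, Equiv.sum_comp σ (fun i => m i * m i)]; linarith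
  rw [e1, EReal.coe_add, ← add_assoc]
  refine (add_le_add_left hm _).trans ?_
  rw [add_assoc, ← EReal.coe_add]
  gcongr
end
end
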